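/- Let t and r be positive integers and let k, n be nonnegative integers. The number of partitions λ with λ_1 = k and λ_r + λ_{t+r} + λ_{2t+r} + ⋯ = n equals the number of pairs (ν, (μ^(1), …, μ^(t))) where ν is a partition with at most r−1 parts, (μ^(1), …, μ^(t)) is a t-tuple of partitions, ν_1 + ℓ(μ^(1)) + ⋯ + ℓ(μ^(t)) = k, and |μ^(1)| + ⋯ + |μ^(t)| = n. (This is the coefficient-wise form of the identity ∑_{λ∈𝒫} z^{λ_1} q^{λ_r+λ_{t+r}+λ_{2t+r}+⋯} = 1/((1−z)^{r−1} (qz;q)_∞^t).) -/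

import Mathlib

/-- A partition: a weakly decreasing sequence of naturals with finite support.
`p.parts i` is the `(i+1)`-st part, i.e. parts are 0-indexed (`λ_1 = p.parts 0`). -/
structure Ptn where
  parts : ℕ → ℕ
  antitone' : ∀ ⦃i j : ℕ⦄, i ≤ j → parts j ≤ parts i
  finite_support' : (Function.support parts).Finite

namespace Ptn

/-- The size `|λ|` of a partition: the sum of all its parts. -/
noncomputable def size (p : Ptn) : ℕ := ∑ᶠ i, p.parts i

/-- The number of (nonzero) parts `ℓ(λ)`. -/
noncomputable def length (p : Ptn) : ℕ := (Function.support p.parts).ncard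

/-- A partition has distinct parts if no nonzero value is repeated. -/
def Distinct (p : Ptn) : Prop := ∀ i : ℕ, p.parts (i + 1) ≠ 0 → p.parts (i + 1) < p.parts i

/-- A partition has odd parts if every part is odd. -/
def OddParts (p : Ptn) : Prop := ∀ i : ℕ, p.parts i ≠ 0 → Odd (p.parts i)

end Ptn

namespace Ptn

theorem ext_parts {p q : Ptn} (h : ∀ i, p.parts i = q.parts i) : p = q := by
  cases p
  cases q
  congr
  exact funext h

theorem exists_forall_ge_eq_zero (p : Ptn) : ∃ N, ∀ i, N ≤ i → p.parts i = 0 := by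
  obtain ⟨N, hN⟩ := p.finite_support'.bddAbove
  refine ⟨N + 1, fun i hi => ?_⟩
  by_contra h
  have : i ≤ N := hN h
  omega

theorem finite_support_of_eventually_zero {f : ℕ → ℕ} {N : ℕ} (h : ∀ i, N ≤ i → f i = 0) :
    (Function.support f).Finite := by
  refine (Set.finite_Iio N).subset fun i hi => ?_
  by_contra hiN
  exact hi (h i (not_lt.mp hiN))

/-- Two partitions with the same consecutive differences are equal. -/
theorem eq_of_differences {p q : Ptn}
    (h : ∀ i, p.parts i + q.parts (i + 1) = q.parts i + p.parts (i + 1)) : p = q := by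
  obtain ⟨M, hM⟩ := p.exists_forall_ge_eq_zero
  obtain ⟨N, hN⟩ := q.exists_forall_ge_eq_zero
  have key : ∀ k i, M + N ≤ i + k → p.parts i = q.parts i := by
    intro k
    induction k with
    | zero =>
      intro i hi
      rw [hM i (by omega), hN i (by omega)]
    | succ k ih =>
      intro i hi
      have := ih (i + 1) (by omega)
      have := h i
      omega
  exact ext_parts fun i => key (M + N) i (by omega)

theorem exists_parts_le (p : Ptn) (s : ℕ) : ∃ i, p.parts i ≤ s := by
  obtain ⟨N, hN⟩ := p.exists_forall_ge_eq_zero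
  exact ⟨N, by simp [hN N le_rfl]⟩

theorem lt_find_iff (p : Ptn) (s i : ℕ) : i < Nat.find (p.exists_parts_le s) ↔ s < p.parts i := by
  rw [Nat.lt_find_iff]
  constructor
  · intro h
    exact not_le.mp (h i le_rfl)
  · intro h j hj
    have := p.antitone' hj
    omega

/-- The conjugate partition. -/
noncomputable def conj (p : Ptn) : Ptn where
  parts s := Nat.find (p.exists_parts_le s)
  antitone' s s' h := by
    refine le_of_forall_lt fun i hi => ?_
    rw [lt_find_iff] at hi ⊢
    omega
  finite_support' := by
    refine finite_support_of_eventually_zero (N := p.parts 0) fun s hs => ?_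
    by_contra h
    have := (p.lt_find_iff s 0).mp (Nat.pos_of_ne_zero h)
    omega

theorem lt_conj_iff (p : Ptn) (s i : ℕ) : i < p.conj.parts s ↔ s < p.parts i :=
  p.lt_find_iff s i

theorem conj_conj (p : Ptn) : p.conj.conj = p :=
  ext_parts fun i => eq_of_forall_lt_iff fun s => by rw [lt_conj_iff, lt_conj_iff]

theorem length_eq_conj (p : Ptn) : p.length = p.conj.parts 0 := by
  have : Function.support p.parts = ↑(Finset.range (p.conj.parts 0)) := by
    ext i
    simp [lt_conj_iff, Nat.pos_iff_ne_zero]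
  rw [length, this, Set.ncard_coe_finset, Finset.card_range]

theorem length_le_iff (p : Ptn) (a : ℕ) : p.length ≤ a ↔ p.parts a = 0 := by
  rw [length_eq_conj, ← not_lt, lt_conj_iff]
  omega

theorem size_eq_sum (p : Ptn) {N : ℕ} (hN : ∀ i, N ≤ i → p.parts i = 0) :
    p.size = ∑ i ∈ Finset.range N, p.parts i := by
  refine finsum_eq_sum_of_support_subset _ fun i hi => ?_
  by_contra h
  exact hi (hN i (by simpa using h))

theorem size_conj (p : Ptn) : p.conj.size = p.size := by
  obtain ⟨M, hM⟩ := p.exists_forall_ge_eq_zero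
  obtain ⟨N, hN⟩ := p.conj.exists_forall_ge_eq_zero
  have card_eq (q : Ptn) (i K : ℕ) (hK : ∀ s, K ≤ s → q.conj.parts s = 0) :
      q.parts i = ∑ s ∈ Finset.range K, if s < q.parts i then 1 else 0 := by
    rw [← Finset.card_filter]
    have : (Finset.range K).filter (· < q.parts i) = Finset.range (q.parts i) := by
      ext s
      simp only [Finset.mem_filter, Finset.mem_range, and_iff_right_iff_imp]
      intro hs
      by_contra h
      have h₁ := hK s (not_lt.mp h)
      have h₂ := (q.lt_conj_iff s i).mpr hs
      omega
    rw [this, Finset.card_range]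
  rw [p.size_eq_sum hM, p.conj.size_eq_sum hN,
    Finset.sum_congr rfl fun i _ => card_eq p i N hN,
    Finset.sum_congr rfl fun s _ => card_eq p.conj s M (by rwa [conj_conj]), Finset.sum_comm]
  simp only [lt_conj_iff]

/-- The partition whose consecutive differences are prescribed by `c`. -/
noncomputable def ofDifferences (c : ℕ → ℕ) (hc : (Function.support c).Finite) : Ptn where
  parts s := ∑ j ∈ hc.toFinset.filter (s ≤ ·), c j
  antitone' s s' h := by
    refine Finset.sum_le_sum_of_subset fun j hj => ?_
    simp only [Finset.mem_filter] at hj ⊢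
    exact ⟨hj.1, h.trans hj.2⟩
  finite_support' := by
    refine finite_support_of_eventually_zero (N := hc.toFinset.sup id + 1) fun s hs => ?_
    refine Finset.sum_eq_zero fun j hj => ?_
    rw [Finset.mem_filter] at hj
    have : j ≤ hc.toFinset.sup id := Finset.le_sup (f := id) hj.1
    omega

theorem ofDifferences_parts (c : ℕ → ℕ) (hc : (Function.support c).Finite) (s : ℕ) :
    (ofDifferences c hc).parts s = c s + (ofDifferences c hc).parts (s + 1) := by
  simp only [ofDifferences, Finset.sum_filter]
  have h : c s = ∑ j ∈ hc.toFinset, if j = s then c j else 0 := by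
    rw [Finset.sum_ite_eq']
    by_cases hs : c s = 0 <;> simp [hs]
  rw [h, ← Finset.sum_add_distrib]
  refine Finset.sum_congr rfl fun j _ => ?_
  split_ifs <;> omega

/-- Interleave `t` partitions `κ 0, …, κ (t - 1)` after position `a`, and add `ν`. -/
def interleave (a t : ℕ) (ht : 1 ≤ t) (ν : Ptn) (κ : Fin t → Ptn) : Ptn where
  parts j := ν.parts j + ∑ i, (κ i).parts ((j - a + (t - 1 - i)) / t)
  antitone' j j' h := by
    refine add_le_add (ν.antitone' h) (Finset.sum_le_sum fun i _ => (κ i).antitone' ?_)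
    exact Nat.div_le_div_right (by omega)
  finite_support' := by
    obtain ⟨M, hM⟩ := ν.exists_forall_ge_eq_zero
    choose N hN using fun i => (κ i).exists_forall_ge_eq_zero
    refine finite_support_of_eventually_zero (N := M + a + t * ∑ i, N i) fun j hj => ?_
    rw [hM j (by omega), zero_add]
    refine Finset.sum_eq_zero fun i _ => hN i _ ?_
    have h₁ : N i ≤ ∑ i, N i := Finset.single_le_sum (fun _ _ => Nat.zero_le _) (Finset.mem_univ i)
    rw [Nat.le_div_iff_mul_le (by omega), mul_comm]
    have := Nat.mul_le_mul_left t h₁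
    omega

section Interleave

variable {a t : ℕ} (ht : 1 ≤ t) (ν : Ptn) (κ : Fin t → Ptn)

theorem interleave_parts_of_le {j : ℕ} (hj : j ≤ a) :
    (interleave a t ht ν κ).parts j = ν.parts j + ∑ i, (κ i).parts 0 := by
  simp only [interleave]
  congr 1
  refine Finset.sum_congr rfl fun i _ => ?_
  rw [Nat.div_eq_of_lt (by omega)]

theorem interleave_parts_mul_add (hν : ν.parts a = 0) (m : ℕ) :
    (interleave a t ht ν κ).parts (m * t + a) = ∑ i, (κ i).parts m := by
  have : ν.parts (m * t + a) = 0 := by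
    have := ν.antitone' (show a ≤ m * t + a by omega)
    omega
  simp only [interleave, this, zero_add, Nat.add_sub_cancel]
  refine Finset.sum_congr rfl fun i _ => ?_
  rw [mul_comm m t, Nat.mul_add_div (by omega), Nat.div_eq_of_lt (by omega), add_zero]

theorem interleave_parts_succ (hν : ν.parts a = 0) (s : ℕ) (i : Fin t) :
    (interleave a t ht ν κ).parts (a + (t * s + i)) + (κ i).parts (s + 1) =
      (interleave a t ht ν κ).parts (a + (t * s + i) + 1) + (κ i).parts s := by
  have hz : ∀ j, a ≤ j → ν.parts j = 0 := fun j hj => by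
    have := ν.antitone' hj
    omega
  have hi := i.isLt
  simp only [interleave]
  rw [hz _ (by omega), hz _ (by omega), zero_add, zero_add,
    ← Finset.add_sum_erase _ _ (Finset.mem_univ i), ← Finset.add_sum_erase _ _ (Finset.mem_univ i)]
  have e₁ : (a + (t * s + i) - a + (t - 1 - i)) / t = s := by
    rw [show a + (t * s + i) - a + (t - 1 - i) = t * s + (t - 1) by omega,
      Nat.mul_add_div (by omega), Nat.div_eq_of_lt (by omega), add_zero]
  have e₂ : (a + (t * s + i) + 1 - a + (t - 1 - i)) / t = s + 1 := by
    rw [show a + (t * s + i) + 1 - a + (t - 1 - i) = t * s + t by omega,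
      Nat.mul_add_div (by omega), Nat.div_self (by omega)]
  have e₃ : ∑ x ∈ Finset.univ.erase i, (κ x).parts ((a + (t * s + i) - a + (t - 1 - x)) / t) =
      ∑ x ∈ Finset.univ.erase i, (κ x).parts ((a + (t * s + i) + 1 - a + (t - 1 - x)) / t) := by
    refine Finset.sum_congr rfl fun x hx => ?_
    have hx' : (x : ℕ) ≠ i := fun h => (Finset.mem_erase.mp hx).1 (Fin.ext h)
    have hxt := x.isLt
    congr 1
    rw [show a + (t * s + i) - a + (t - 1 - x) = t * s + (i + (t - 1 - x)) by omega,
      show a + (t * s + i) + 1 - a + (t - 1 - x) = t * s + (i + (t - 1 - x) + 1) by omega,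
      Nat.mul_add_div (by omega), Nat.mul_add_div (by omega)]
    congr 1
    rcases lt_or_gt_of_ne hx' with h | h
    · rw [Nat.div_eq_of_lt_le (k := 1) (by omega) (by omega),
        Nat.div_eq_of_lt_le (k := 1) (by omega) (by omega)]
    · rw [Nat.div_eq_of_lt (by omega), Nat.div_eq_of_lt (by omega)]
  rw [e₁, e₂, e₃]
  omega

theorem finsum_interleave (hν : ν.parts a = 0) :
    ∑ᶠ m : ℕ, (interleave a t ht ν κ).parts (m * t + a) = ∑ i, (κ i).size := by
  simp only [interleave_parts_mul_add ht ν κ hν]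
  exact finsum_sum_comm _ _ fun i _ => (κ i).finite_support'

variable {ν κ}

theorem interleave_injective {ν' : Ptn} {κ' : Fin t → Ptn} (hν : ν.parts a = 0)
    (hν' : ν'.parts a = 0) (h : interleave a t ht ν κ = interleave a t ht ν' κ') :
    ν = ν' ∧ κ = κ' := by
  have hκ : κ = κ' := by
    funext i
    refine eq_of_differences fun s => ?_
    have h₁ := interleave_parts_succ ht ν κ hν s i
    have h₂ := interleave_parts_succ ht ν' κ' hν' s i
    rw [h] at h₁
    omega
  refine ⟨ext_parts fun j => ?_, hκ⟩
  have := congrArg (fun p => p.parts j) h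
  simpa [interleave, hκ] using this

theorem exists_interleave_eq (a : ℕ) (p : Ptn) :
    ∃ ν κ, ν.parts a = 0 ∧ interleave a t ht ν κ = p := by
  obtain ⟨N, hN⟩ := p.exists_forall_ge_eq_zero
  let ν : Ptn :=
    { parts := fun j => p.parts j - p.parts a
      antitone' := fun j j' h => Nat.sub_le_sub_right (p.antitone' h) _
      finite_support' := finite_support_of_eventually_zero (N := N) fun j hj => by simp [hN j hj] }
  have hc (i : Fin t) : (Function.support fun s =>
      p.parts (a + (t * s + i)) - p.parts (a + (t * s + i) + 1)).Finite := by
    refine finite_support_of_eventually_zero (N := N) fun s hs => ?_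
    have := Nat.le_mul_of_pos_left s ht
    rw [hN _ (by omega), Nat.zero_sub]
  let κ (i : Fin t) : Ptn := ofDifferences _ (hc i)
  have hκ (i : Fin t) (s : ℕ) : (κ i).parts s =
      p.parts (a + (t * s + i)) - p.parts (a + (t * s + i) + 1) + (κ i).parts (s + 1) :=
    ofDifferences_parts _ (hc i) s
  have hν : ν.parts a = 0 := Nat.sub_self _
  refine ⟨ν, κ, hν, eq_of_differences fun j => ?_⟩
  rcases lt_or_ge j a with hj | hj
  · rw [interleave_parts_of_le ht ν κ hj.le, interleave_parts_of_le ht ν κ (Nat.succ_le_of_lt hj)]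
    have h₁ := p.antitone' hj.le
    have h₂ := p.antitone' (Nat.succ_le_of_lt hj)
    simp only [ν, Nat.succ_eq_add_one] at *
    omega
  · have hs := interleave_parts_succ ht ν κ hν ((j - a) / t) ⟨(j - a) % t, Nat.mod_lt _ ht⟩
    have hd := hκ ⟨(j - a) % t, Nat.mod_lt _ ht⟩ ((j - a) / t)
    have hj' : a + (t * ((j - a) / t) + (j - a) % t) = j := by
      rw [Nat.div_add_mod]
      omega
    have hp := p.antitone' (Nat.le_succ j)
    simp only [hj', Nat.succ_eq_add_one] at hs hd hp
    omega

end Interleave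

end Ptn

/-- Coefficient-wise form of
`∑_{λ∈𝒫} z^{λ_1} q^{λ_r+λ_{t+r}+λ_{2t+r}+⋯} = 1/((1-z)^{r-1} (qz;q)_∞^t)`:
partitions `λ` with `λ_1 = k` and `λ_r + λ_{t+r} + λ_{2t+r} + ⋯ = n` are equinumerous
with pairs `(ν, μ)` of a partition `ν` with at most `r-1` parts and a `t`-tuple `μ` of
partitions with `ν_1 + ∑ ℓ(μ i) = k` and `∑ |μ i| = n`. -/
theorem color_conjugate_identity_one (t r : ℕ) (ht : 1 ≤ t) (hr : 1 ≤ r) (k n : ℕ) :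
    {p : Ptn | p.parts 0 = k ∧ (∑ᶠ m : ℕ, p.parts (m * t + r - 1)) = n}.ncard
      = {q : Ptn × (Fin t → Ptn) | q.1.length ≤ r - 1 ∧
          q.1.parts 0 + (∑ i, (q.2 i).length) = k ∧ (∑ i, (q.2 i).size) = n}.ncard := by
  simp only [Nat.add_sub_assoc hr, Ptn.length_le_iff]
  simp only [Ptn.length_eq_conj]
  generalize r - 1 = a
  let f (q : Ptn × (Fin t → Ptn)) : Ptn := Ptn.interleave a t ht q.1 fun i => (q.2 i).conj
  have hf₀ (q) : (f q).parts 0 = q.1.parts 0 + ∑ i, (q.2 i).conj.parts 0 :=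
    Ptn.interleave_parts_of_le ht _ _ (Nat.zero_le a)
  have hf (q : Ptn × (Fin t → Ptn)) (hq : q.1.parts a = 0) :
      ∑ᶠ m : ℕ, (f q).parts (m * t + a) = ∑ i, (q.2 i).size := by
    simpa only [Ptn.size_conj] using
      Ptn.finsum_interleave ht q.1 (fun i => (q.2 i).conj) hq
  symm
  refine Set.ncard_congr (fun q _ => f q) ?_ ?_ ?_
  · rintro q ⟨hq, h₀, h₁⟩
    exact ⟨(hf₀ q).trans h₀, (hf q hq).trans h₁⟩
  · rintro ⟨ν, μ⟩ ⟨ν', μ'⟩ ⟨hq, -⟩ ⟨hq', -⟩ h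
    obtain ⟨h₁, h₂⟩ := Ptn.interleave_injective ht hq hq' h
    refine Prod.ext h₁ (funext fun i => ?_)
    simpa only [Ptn.conj_conj] using congrArg Ptn.conj (congrFun h₂ i)
  · rintro p ⟨h₀, h₁⟩
    obtain ⟨ν, κ, hν, rfl⟩ := Ptn.exists_interleave_eq ht a p
    have hp : f (ν, fun i => (κ i).conj) = Ptn.interleave a t ht ν κ := by
      simp only [f, Ptn.conj_conj]
    refine ⟨(ν, fun i => (κ i).conj), ⟨hν, ?_, ?_⟩, hp⟩
    · rw [← hf₀, hp, h₀]
    · rw [← hf _ hν, hp, h₁]
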